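/- arXiv:2502.01876 — 2 statements merged into one kernel-verified Lean document; each statement's English description precedes it below -/
import Mathlib

section
/- Let d, K, m ≥ 1, let λ > 0, α > 0 and H > 0, and let φ_{k,i} ∈ ℝ^d for k ∈ {1,…,K}, i ∈ {1,…,m} satisfy ‖φ_{k,i}‖₂ ≤ H/m. Define Σ_0 := α λ I and Σ_k := α λ I + ∑_{k'=1}^{k} ∑_{i=1}^{m} φ_{k',i} φ_{k',i}ᵀ for k ≥ 1. Then ∑_{k=1}^{K} ∑_{i=1}^{m} √(φ_{k,i}ᵀ Σ_{k-1}⁻¹ φ_{k,i}) ≤ √( 2·K·m·d · max{H²/(m·α·λ), 1} · log(1 + K·H²/(α·λ·d·m)) ). -/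
open Matrix

namespace Matrix

variable {n ι : Type*} [Fintype ι]

lemma sum_vecMulVec_self (v : ι → n → ℝ) :
    ∑ i, vecMulVec (v i) (v i) = (of v)ᵀ * of v := by
  ext a b
  simp [mul_apply, vecMulVec_apply, sum_apply]

lemma PosSemidef.posDef_smul_one_add [DecidableEq n] {P : Matrix n n ℝ} (hP : P.PosSemidef) {c : ℝ}
    (hc : 0 < c) : (c • (1 : Matrix n n ℝ) + P).PosDef :=
  (PosDef.one.smul hc).add_posSemidef hP

variable [Fintype n]

lemma posSemidef_sum_vecMulVec_self (v : ι → n → ℝ) :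
    (∑ i, vecMulVec (v i) (v i)).PosSemidef := by
  rw [sum_vecMulVec_self]
  exact posSemidef_conjTranspose_mul_self (of v)

variable [DecidableEq n]

lemma PosSemidef.one_add_trace_le_det_one_add {P : Matrix n n ℝ} (hP : P.PosSemidef) :
    1 + P.trace ≤ (1 + P).det := by
  have hprod : ∀ (s : Finset n) (f : n → ℝ), (∀ i, 0 ≤ f i) →
      1 + ∑ i ∈ s, f i ≤ ∏ i ∈ s, (1 + f i) := by
    intro s f hf
    induction s using Finset.induction_on with
    | empty => simp
    | insert a s ha ih =>
      rw [Finset.sum_insert ha, Finset.prod_insert ha]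
      nlinarith [hf a, mul_le_mul_of_nonneg_left ih (hf a),
        mul_nonneg (hf a) (Finset.sum_nonneg fun i (_ : i ∈ s) => hf i)]
  have hdet : (1 + P).det = ∏ i, (1 + hP.1.eigenvalues i) := by
    have h := congrArg (Polynomial.eval (-1 : ℝ)) hP.1.charpoly_eq
    rw [eval_charpoly, Polynomial.eval_prod] at h
    have e : (1 + P) = -(scalar n (-1 : ℝ) - P) := by
      rw [map_neg, map_one]
      abel
    rw [e, det_neg, h, ← Finset.card_univ, ← Finset.prod_const, ← Finset.prod_mul_distrib]
    refine Finset.prod_congr rfl fun i _ => ?_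
    simp
    ring
  rw [hdet, hP.1.trace_eq_sum_eigenvalues]
  exact hprod _ _ hP.eigenvalues_nonneg

lemma PosDef.det_mul_one_add_sum_le {A : Matrix n n ℝ} (hA : A.PosDef) (v : ι → n → ℝ) :
    A.det * (1 + ∑ i, v i ⬝ᵥ A⁻¹ *ᵥ v i) ≤ (A + ∑ i, vecMulVec (v i) (v i)).det := by
  classical
  have hP : (of v * A⁻¹ * (of v)ᵀ).PosSemidef :=
    hA.inv.posSemidef.mul_mul_conjTranspose_same (of v)
  have htr : (of v * A⁻¹ * (of v)ᵀ).trace = ∑ i, v i ⬝ᵥ A⁻¹ *ᵥ v i := by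
    refine Finset.sum_congr rfl fun i _ => ?_
    rw [Matrix.mul_assoc, diag_apply, mul_apply]
    rfl
  rw [sum_vecMulVec_self, det_add_mul _ _ ((isUnit_iff_isUnit_det A).1 hA.isUnit), ← htr]
  exact mul_le_mul_of_nonneg_left hP.one_add_trace_le_det_one_add hA.det_pos.le

lemma PosDef.log_det_le {A : Matrix n n ℝ} (hA : A.PosDef) {c : ℝ} (hc : 0 < c)
    (htr : A.trace ≤ Fintype.card n * c) : Real.log A.det ≤ Fintype.card n * Real.log c := by
  have hpos := hA.eigenvalues_pos
  have htr' := hA.1.trace_eq_sum_eigenvalues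
  rw [hA.1.det_eq_prod_eigenvalues]
  simp only [RCLike.ofReal_real_eq_id, id] at htr' ⊢
  rw [Real.log_prod fun i _ => (hpos i).ne']
  calc ∑ i, Real.log (hA.1.eigenvalues i)
      ≤ ∑ i, (Real.log c + (hA.1.eigenvalues i / c - 1)) := by
        refine Finset.sum_le_sum fun i _ => ?_
        have := Real.log_le_sub_one_of_pos (div_pos (hpos i) hc)
        rw [Real.log_div (hpos i).ne' hc.ne'] at this
        linarith
    _ = Fintype.card n * Real.log c + (A.trace / c - Fintype.card n) := by
        rw [htr', Finset.sum_add_distrib, Finset.sum_sub_distrib, Finset.sum_div]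
        simp
    _ ≤ _ := by
        have := (div_le_iff₀ hc).2 htr
        linarith

lemma PosSemidef.dotProduct_inv_smul_one_add_le {P : Matrix n n ℝ} (hP : P.PosSemidef) {c : ℝ}
    (hc : 0 < c) (v : n → ℝ) :
    v ⬝ᵥ (c • (1 : Matrix n n ℝ) + P)⁻¹ *ᵥ v ≤ (v ⬝ᵥ v) / c := by
  have hA := hP.posDef_smul_one_add hc
  set A := c • (1 : Matrix n n ℝ) + P with hAdef
  set x := A⁻¹ *ᵥ v with hx
  have hv : A *ᵥ x = v := by
    rw [hx, mulVec_mulVec, mul_nonsing_inv _ ((isUnit_iff_isUnit_det A).1 hA.isUnit), one_mulVec]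
  have hxP : 0 ≤ x ⬝ᵥ P *ᵥ x := by simpa using hP.dotProduct_mulVec_nonneg x
  have hlow : c * (x ⬝ᵥ x) ≤ v ⬝ᵥ x := by
    have : v ⬝ᵥ x = c * (x ⬝ᵥ x) + x ⬝ᵥ P *ᵥ x := by
      rw [dotProduct_comm v x]
      nth_rewrite 1 [← hv]
      rw [hAdef, add_mulVec, smul_mulVec, one_mulVec, dotProduct_add, dotProduct_smul, smul_eq_mul]
    linarith
  have hsq : 0 ≤ (v - c • x) ⬝ᵥ (v - c • x) := Finset.sum_nonneg fun i _ => mul_self_nonneg _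
  simp only [sub_dotProduct, dotProduct_sub, smul_dotProduct, dotProduct_smul, smul_eq_mul,
    dotProduct_comm x v] at hsq
  rw [le_div_iff₀ hc]
  nlinarith

end Matrix

lemma Real.le_two_mul_max_mul_log_one_add {s M : ℝ} (hs : 0 ≤ s) (hM : s ≤ M) :
    s ≤ 2 * max M 1 * Real.log (1 + s) := by
  have hlog : 0 ≤ Real.log (1 + s) := Real.log_nonneg (by linarith)
  rcases le_total s 1 with h | h
  · have h1 := Real.one_sub_inv_le_log_of_pos (show 0 < 1 + s by linarith)
    have h2 : s / 2 ≤ 1 - (1 + s)⁻¹ := by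
      have : 1 - (1 + s)⁻¹ = s / (1 + s) := by field_simp; ring
      rw [this]
      gcongr
      linarith
    nlinarith [le_max_right M 1]
  · have h1 : Real.log 2 ≤ Real.log (1 + s) := Real.log_le_log (by norm_num) (by linarith)
    have h2 := Real.log_two_gt_d9
    nlinarith [le_max_left M 1, le_max_right M 1]

/-- Elliptical potential bound with regularization `αλ`: with
`Σ_k = αλI + ∑_{k'≤k} ∑_i φ_{k',i}φ_{k',i}ᵀ` and `‖φ_{k,i}‖₂ ≤ H/m`,
`∑_k ∑_i ‖φ_{k,i}‖_{Σ_{k-1}⁻¹} ≤ √(2Kmd · max{H²/(mαλ), 1} · log(1 + KH²/(αλdm)))`. -/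
theorem sum_seg_norm_bound_alpha
    (d K m : ℕ) (hd : 1 ≤ d) (hK : 1 ≤ K) (hm : 1 ≤ m)
    (lam α H : ℝ) (hlam : 0 < lam) (hα : 0 < α) (hH : 0 < H)
    (φ : Fin K → Fin m → Fin d → ℝ)
    (hφ : ∀ (k : Fin K) (i : Fin m), Real.sqrt (∑ x : Fin d, (φ k i x) ^ 2) ≤ H / m)
    (Sig : ℕ → Matrix (Fin d) (Fin d) ℝ)
    (hSig : ∀ k : ℕ, Sig k = (α * lam) • (1 : Matrix (Fin d) (Fin d) ℝ)
        + ∑ k' : Fin K, ∑ i : Fin m,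
            if (k' : ℕ) < k then Matrix.vecMulVec (φ k' i) (φ k' i) else 0) :
    ∑ k : Fin K, ∑ i : Fin m, Real.sqrt (φ k i ⬝ᵥ (Sig (k : ℕ))⁻¹ *ᵥ φ k i)
      ≤ Real.sqrt (2 * K * m * d * max (H ^ 2 / (m * α * lam)) 1
          * Real.log (1 + (K : ℝ) * H ^ 2 / (α * lam * d * m))) := by
  have hc : 0 < α * lam := mul_pos hα hlam
  have hm' : (0 : ℝ) < m := by exact_mod_cast hm
  have hd' : (0 : ℝ) < d := by exact_mod_cast hd
  set c := α * lam with hcdef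
  set M := H ^ 2 / (m * α * lam) with hMdef
  set s : Fin K → ℝ := fun k => ∑ i, φ k i ⬝ᵥ (Sig k)⁻¹ *ᵥ φ k i with hs
  have hnorm : ∀ k i, φ k i ⬝ᵥ φ k i ≤ (H / m) ^ 2 := by
    intro k i
    have h := (Real.sqrt_le_left (by positivity)).1 (hφ k i)
    simpa [dotProduct, sq] using h
  have hpsd : ∀ k : ℕ, (∑ k' : Fin K, ∑ i : Fin m,
      if (k' : ℕ) < k then vecMulVec (φ k' i) (φ k' i) else 0).PosSemidef := by
    refine fun k => posSemidef_sum _ fun k' _ => ?_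
    split_ifs
    · exact posSemidef_sum_vecMulVec_self _
    · simpa using PosSemidef.zero
  have hpd : ∀ k, (Sig k).PosDef := fun k => by
    rw [hSig k]
    exact (hpsd k).posDef_smul_one_add hc
  have hq0 : ∀ (k : Fin K) i, 0 ≤ φ k i ⬝ᵥ (Sig k)⁻¹ *ᵥ φ k i := fun k i => by
    simpa using (hpd k).inv.posSemidef.dotProduct_mulVec_nonneg (φ k i)
  have hs0 : ∀ k, 0 ≤ s k := fun k => Finset.sum_nonneg fun i _ => hq0 k i
  have hsM : ∀ k, s k ≤ M := by
    intro k
    calc s k ≤ ∑ _i : Fin m, (H / m) ^ 2 / c := by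
          refine Finset.sum_le_sum fun i _ => ?_
          have h := (hpsd k).dotProduct_inv_smul_one_add_le hc (φ k i)
          rw [← hSig k] at h
          exact h.trans (div_le_div_of_nonneg_right (hnorm k i) hc.le)
      _ = M := by
          simp only [Finset.sum_const, Finset.card_univ, Fintype.card_fin, nsmul_eq_mul, hMdef,
            hcdef]
          field_simp
  have hstep : ∀ k : Fin K,
      Sig (k + 1) = Sig k + ∑ i, vecMulVec (φ k i) (φ k i) := by
    intro k
    rw [hSig, hSig, add_assoc]
    congr 1
    have : ∑ i, vecMulVec (φ k i) (φ k i) = ∑ k' : Fin K, ∑ i : Fin m,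
        if k' = k then vecMulVec (φ k' i) (φ k' i) else 0 := by
      rw [Finset.sum_eq_single k (fun b _ hb => by simp [hb]) (by simp)]
      simp
    rw [this, ← Finset.sum_add_distrib]
    refine Finset.sum_congr rfl fun k' _ => ?_
    rw [← Finset.sum_add_distrib]
    refine Finset.sum_congr rfl fun i _ => ?_
    rcases lt_trichotomy k' k with h | h | h
    · have h' : (k' : ℕ) < k := h
      simp [h', h.ne, h'.trans (Nat.lt_succ_self _)]
    · simp [h]
    · have h' : (k : ℕ) < k' := h
      simp [h'.not_gt, h.ne', Nat.not_lt.2 (Nat.succ_le_of_lt h')]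
  have hlogstep : ∀ k : Fin K,
      Real.log (1 + s k) ≤ Real.log (Sig (k + 1)).det - Real.log (Sig k).det := by
    intro k
    have h := (hpd k).det_mul_one_add_sum_le (φ k)
    rw [← hstep k] at h
    have h1 : 0 < 1 + s k := by linarith [hs0 k]
    have h2 := Real.log_le_log (mul_pos (hpd k).det_pos h1) h
    rw [Real.log_mul (hpd k).det_pos.ne' h1.ne'] at h2
    linarith
  have hdet0 : Real.log (Sig 0).det = d * Real.log c := by
    rw [hSig 0]
    simp
  have htr : (Sig K).trace ≤ d * (c + K * H ^ 2 / (d * m)) := by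
    rw [hSig K, trace_add, trace_smul, trace_one, trace_sum]
    have : ∑ k' : Fin K, (∑ i : Fin m,
        if (k' : ℕ) < K then vecMulVec (φ k' i) (φ k' i) else 0).trace
        ≤ ∑ _k' : Fin K, ∑ _i : Fin m, (H / m) ^ 2 := by
      refine Finset.sum_le_sum fun k' _ => ?_
      rw [trace_sum]
      refine Finset.sum_le_sum fun i _ => ?_
      rw [if_pos k'.2, trace_vecMulVec]
      exact hnorm k' i
    refine (add_le_add_right this _).trans_eq ?_
    simp only [Finset.sum_const, Finset.card_univ, Fintype.card_fin, nsmul_eq_mul, smul_eq_mul]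
    field_simp
  have hdetK : Real.log (Sig K).det ≤ d * Real.log (c + K * H ^ 2 / (d * m)) := by
    have h := (hpd K).log_det_le (c := c + K * H ^ 2 / (d * m)) (by positivity)
      (by simpa using htr)
    simpa using h
  have hlogsum : ∑ k, Real.log (1 + s k)
      ≤ d * Real.log (1 + (K : ℝ) * H ^ 2 / (c * d * m)) := by
    have htel : ∑ k : Fin K, (Real.log (Sig (k + 1)).det - Real.log (Sig k).det)
        = Real.log (Sig K).det - Real.log (Sig 0).det := by
      rw [Fin.sum_univ_eq_sum_range
        (fun k => Real.log (Sig (k + 1)).det - Real.log (Sig k).det) K]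
      exact Finset.sum_range_sub (fun k => Real.log (Sig k).det) K
    have hfac : c + K * H ^ 2 / (d * m) = c * (1 + (K : ℝ) * H ^ 2 / (c * d * m)) := by
      field_simp
    have hlogfac : Real.log (c + K * H ^ 2 / (d * m))
        = Real.log c + Real.log (1 + (K : ℝ) * H ^ 2 / (c * d * m)) := by
      rw [hfac, Real.log_mul hc.ne' (by positivity)]
    have h := Finset.sum_le_sum fun k (_ : k ∈ Finset.univ) => hlogstep k
    rw [htel, hdet0] at h
    rw [hlogfac] at hdetK
    linarith
  have hssum : ∑ k, s k
      ≤ 2 * max M 1 * (d * Real.log (1 + (K : ℝ) * H ^ 2 / (c * d * m))) := by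
    calc ∑ k, s k ≤ ∑ k, 2 * max M 1 * Real.log (1 + s k) :=
          Finset.sum_le_sum fun k _ => Real.le_two_mul_max_mul_log_one_add (hs0 k) (hsM k)
      _ = 2 * max M 1 * ∑ k, Real.log (1 + s k) := by rw [Finset.mul_sum]
      _ ≤ _ := by gcongr
  refine Real.le_sqrt_of_sq_le ?_
  have hcs := sq_sum_le_card_mul_sum_sq (s := (Finset.univ : Finset (Fin K × Fin m)))
    (f := fun p => Real.sqrt (φ p.1 p.2 ⬝ᵥ (Sig p.1)⁻¹ *ᵥ φ p.1 p.2))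
  simp only [Real.sq_sqrt (hq0 _ _), Fintype.sum_prod_type, Finset.card_univ,
    Fintype.card_prod, Fintype.card_fin, Nat.cast_mul] at hcs
  refine hcs.trans ((mul_le_mul_of_nonneg_left hssum (by positivity)).trans_eq ?_)
  ring
end

section
/- Let d, K, m ≥ 1, let H > 0 and 0 < λ ≤ H²/m, and let φ_{k,i} ∈ ℝ^d for k ∈ {1,…,K}, i ∈ {1,…,m} satisfy ‖φ_{k,i}‖₂ ≤ H/m. Define Σ_0 := λ I and Σ_k := λ I + ∑_{k'=1}^{k} ∑_{i=1}^{m} φ_{k',i} φ_{k',i}ᵀ. Then ∑_{k=1}^{K} ∑_{i=1}^{m} √(φ_{k,i}ᵀ Σ_{k-1}⁻¹ φ_{k,i}) ≤ H·√( (2·K·d/λ) · log(1 + K·H²/(λ·d·m)) ). -/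
open Matrix

/-- The determinant of `1 + M` dominates `1 + tr M` for positive semidefinite `M`. -/
theorem Matrix.PosSemidef.one_add_trace_le_det_one_add_s17 {n : Type*} [Fintype n] [DecidableEq n]
    {M : Matrix n n ℝ} (hM : M.PosSemidef) : 1 + M.trace ≤ (1 + M).det := by
  have hdet : (1 + M).det = ∏ i, (1 + hM.1.eigenvalues i) := by
    have h1 := congrArg (Polynomial.eval (-1)) hM.1.charpoly_eq
    rw [Matrix.eval_charpoly, Polynomial.eval_prod] at h1
    have h2 : Matrix.scalar n (-1 : ℝ) - M = -(1 + M) := by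
      rw [map_neg, map_one]; abel
    have h3 : ∏ i, Polynomial.eval (-1 : ℝ)
          (Polynomial.X - Polynomial.C ((hM.1.eigenvalues i : ℝ)))
        = ∏ i, -(1 + hM.1.eigenvalues i) := by
      refine Finset.prod_congr rfl fun i _ => ?_
      simp only [Polynomial.eval_sub, Polynomial.eval_X, Polynomial.eval_C]
      ring
    rw [h2, Matrix.det_neg] at h1
    have h4 := h1.trans h3
    rw [Finset.prod_neg, Finset.card_univ] at h4
    exact mul_left_cancel₀ (pow_ne_zero _ (by norm_num)) h4
  have hprod : ∀ s : Finset n,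
      1 + ∑ i ∈ s, hM.1.eigenvalues i ≤ ∏ i ∈ s, (1 + hM.1.eigenvalues i) := by
    intro s
    induction s using Finset.induction_on with
    | empty => simp
    | insert a s ha ih =>
      rw [Finset.sum_insert ha, Finset.prod_insert ha]
      have h0 := hM.eigenvalues_nonneg a
      have hs : 0 ≤ ∑ i ∈ s, hM.1.eigenvalues i :=
        Finset.sum_nonneg fun i _ => hM.eigenvalues_nonneg i
      nlinarith [mul_nonneg h0 hs]
  rw [hdet, hM.1.trace_eq_sum_eigenvalues]
  exact hprod Finset.univ

/-- Updating a positive definite `A` by the Gram matrix of the rows of `V` multiplies the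
determinant by at least `1 + ∑ i, ‖V i‖²_{A⁻¹}`. -/
theorem Matrix.PosDef.det_mul_one_add_sum_le_s17 {m n : Type*} [Fintype m] [Fintype n]
    [DecidableEq m] [DecidableEq n] {A : Matrix n n ℝ} (hA : A.PosDef) (V : m → n → ℝ) :
    A.det * (1 + ∑ i, V i ⬝ᵥ A⁻¹ *ᵥ V i) ≤ (A + ∑ i, vecMulVec (V i) (V i)).det := by
  have hV : ∑ i, vecMulVec (V i) (V i) = (of V)ᵀ * of V := by
    ext a b
    simp [Matrix.sum_apply, vecMulVec_apply, Matrix.mul_apply]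
  have htr : ∑ i, V i ⬝ᵥ A⁻¹ *ᵥ V i = (of V * A⁻¹ * (of V)ᵀ).trace := by
    refine Finset.sum_congr rfl fun i _ => ?_
    rw [diag_apply, Matrix.mul_assoc]
    rfl
  have hP : (of V * A⁻¹ * (of V)ᵀ).PosSemidef := by
    have := hA.inv.posSemidef.mul_mul_conjTranspose_same (of V)
    rwa [conjTranspose_eq_transpose_of_trivial] at this
  rw [hV, det_add_mul _ _ hA.det_pos.ne'.isUnit, htr]
  exact mul_le_mul_of_nonneg_left hP.one_add_trace_le_det_one_add_s17 hA.det_pos.le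

/-- The arithmetic-geometric mean inequality for eigenvalues, in logarithmic form. -/
theorem Matrix.PosDef.log_det_le_s17 {n : Type*} [Fintype n] [DecidableEq n]
    {A : Matrix n n ℝ} (hA : A.PosDef) {t : ℝ} (ht : 0 < t)
    (htr : A.trace ≤ Fintype.card n * t) : Real.log A.det ≤ Fintype.card n * Real.log t := by
  have hdet : A.det = ∏ i, hA.1.eigenvalues i := hA.1.det_eq_prod_eigenvalues
  have htrace : A.trace = ∑ i, hA.1.eigenvalues i := hA.1.trace_eq_sum_eigenvalues
  rw [hdet, Real.log_prod fun i _ => (hA.eigenvalues_pos i).ne']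
  have hpt : ∀ i, Real.log (hA.1.eigenvalues i) ≤
      hA.1.eigenvalues i / t - 1 + Real.log t := by
    intro i
    have h := Real.log_le_sub_one_of_pos (div_pos (hA.eigenvalues_pos i) ht)
    rw [Real.log_div (hA.eigenvalues_pos i).ne' ht.ne'] at h
    linarith
  refine (Finset.sum_le_sum fun i _ => hpt i).trans ?_
  rw [Finset.sum_add_distrib, Finset.sum_sub_distrib, ← Finset.sum_div, ← htrace]
  simp only [Finset.sum_const, Finset.card_univ, nsmul_eq_mul, mul_one]
  have := (div_le_iff₀ ht).2 htr
  linarith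

/-- Regularization by `c • 1` bounds the inverse quadratic form by `‖v‖² / c`. -/
theorem Matrix.PosSemidef.dotProduct_inv_smul_one_add_mulVec_le {n : Type*} [Fintype n]
    [DecidableEq n] {P : Matrix n n ℝ} (hP : P.PosSemidef) {c : ℝ} (hc : 0 < c) (v : n → ℝ) :
    v ⬝ᵥ (c • (1 : Matrix n n ℝ) + P)⁻¹ *ᵥ v ≤ (v ⬝ᵥ v) / c := by
  have hA : (c • (1 : Matrix n n ℝ) + P).PosDef := (PosDef.one.smul hc).add_posSemidef hP
  set y := (c • (1 : Matrix n n ℝ) + P)⁻¹ *ᵥ v with hy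
  have hv : c • y + P *ᵥ y = v := by
    have h : (c • (1 : Matrix n n ℝ) + P) *ᵥ y = v := by
      rw [hy, mulVec_mulVec, mul_nonsing_inv _ hA.det_pos.ne'.isUnit, one_mulVec]
    rwa [add_mulVec, smul_mulVec, one_mulVec] at h
  have hPy : 0 ≤ y ⬝ᵥ P *ᵥ y := by simpa using hP.dotProduct_mulVec_nonneg y
  have hq : c * (y ⬝ᵥ y) ≤ v ⬝ᵥ y := by
    have : y ⬝ᵥ v = c * (y ⬝ᵥ y) + y ⬝ᵥ P *ᵥ y := by
      conv_lhs => rw [← hv]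
      rw [dotProduct_add, dotProduct_smul, smul_eq_mul]
    rw [dotProduct_comm v y]
    linarith
  have hsq : 0 ≤ (v - c • y) ⬝ᵥ (v - c • y) := by
    simpa using dotProduct_star_self_nonneg (v - c • y)
  have hexp : (v - c • y) ⬝ᵥ (v - c • y)
      = v ⬝ᵥ v - 2 * c * (v ⬝ᵥ y) + c * (c * (y ⬝ᵥ y)) := by
    simp only [sub_dotProduct, dotProduct_sub, smul_dotProduct, dotProduct_smul, smul_eq_mul,
      dotProduct_comm y v]
    ring
  rw [le_div_iff₀ hc]
  nlinarith [mul_le_mul_of_nonneg_left hq hc.le]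

/-- On `[0, c]` with `1 ≤ c`, the identity is at most `2 c log (1 + x)`. -/
theorem le_two_mul_mul_log_one_add {x c : ℝ} (hx : 0 ≤ x) (hxc : x ≤ c) (hc : 1 ≤ c) :
    x ≤ 2 * c * Real.log (1 + x) := by
  have hlog := Real.le_log_one_add_of_nonneg hx
  have hfrac : x ≤ 2 * c * (2 * x / (x + 2)) := by
    rw [← mul_div_assoc, le_div_iff₀ (by linarith)]
    nlinarith [mul_le_mul_of_nonneg_left hxc hx, mul_le_mul_of_nonneg_left hc hx]
  exact hfrac.trans (mul_le_mul_of_nonneg_left hlog (by linarith))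

/-- Elliptical potential bound used in the sum-feedback analysis: with `0 < λ ≤ H²/m`,
`Σ_k = λI + ∑_{k'≤k} ∑_i φ_{k',i}φ_{k',i}ᵀ` and `‖φ_{k,i}‖₂ ≤ H/m`, one has
`∑_k ∑_i ‖φ_{k,i}‖_{Σ_{k-1}⁻¹} ≤ H √((2Kd/λ) log(1 + KH²/(λdm)))`. -/
theorem sum_seg_norm_bound_small_lambda
    (d K m : ℕ) (hd : 1 ≤ d) (hK : 1 ≤ K) (hm : 1 ≤ m)
    (lam H : ℝ) (hH : 0 < H) (hlam0 : 0 < lam) (hlam : lam ≤ H ^ 2 / m)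
    (φ : Fin K → Fin m → Fin d → ℝ)
    (hφ : ∀ (k : Fin K) (i : Fin m), Real.sqrt (∑ x : Fin d, (φ k i x) ^ 2) ≤ H / m)
    (Sig : ℕ → Matrix (Fin d) (Fin d) ℝ)
    (hSig : ∀ k : ℕ, Sig k = lam • (1 : Matrix (Fin d) (Fin d) ℝ)
        + ∑ k' : Fin K, ∑ i : Fin m,
            if (k' : ℕ) < k then Matrix.vecMulVec (φ k' i) (φ k' i) else 0) :
    ∑ k : Fin K, ∑ i : Fin m, Real.sqrt (φ k i ⬝ᵥ (Sig (k : ℕ))⁻¹ *ᵥ φ k i)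
      ≤ H * Real.sqrt ((2 * K * d / lam)
          * Real.log (1 + (K : ℝ) * H ^ 2 / (lam * d * m))) := by
  have hm0 : (0 : ℝ) < m := by exact_mod_cast hm
  have hd0 : (0 : ℝ) < d := by exact_mod_cast hd
  have hnorm : ∀ k i, φ k i ⬝ᵥ φ k i ≤ (H / m) ^ 2 := by
    intro k i
    have h := (Real.sqrt_le_left (by positivity)).1 (hφ k i)
    simpa [dotProduct, sq] using h
  have hP : ∀ k : ℕ, (∑ k' : Fin K, ∑ i : Fin m,
      if (k' : ℕ) < k then vecMulVec (φ k' i) (φ k' i) else 0).PosSemidef := by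
    intro k
    refine posSemidef_sum _ fun k' _ => posSemidef_sum _ fun i _ => ?_
    split_ifs
    · simpa using posSemidef_vecMulVec_self_star (φ k' i)
    · exact PosSemidef.zero
  have hpd : ∀ k, (Sig k).PosDef := fun k => by
    rw [hSig]
    exact (PosDef.one.smul hlam0).add_posSemidef (hP k)
  have hstep : ∀ k : Fin K,
      Sig (k + 1) = Sig k + ∑ i : Fin m, vecMulVec (φ k i) (φ k i) := by
    intro k
    have hk : ∑ i : Fin m, vecMulVec (φ k i) (φ k i)
        = ∑ k' : Fin K, if k' = k then ∑ i : Fin m, vecMulVec (φ k' i) (φ k' i) else 0 := by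
      simp
    rw [hSig, hSig, add_assoc, hk, ← Finset.sum_add_distrib]
    congr 1
    refine Finset.sum_congr rfl fun k' _ => ?_
    rcases lt_trichotomy k' k with h | h | h
    · have h1 : (k' : ℕ) < k := h
      simp [h.ne, h1, h1.trans (Nat.lt_succ_self _)]
    · simp [h]
    · have h1 : (k : ℕ) < k' := h
      simp [h.ne', show ¬ (k' : ℕ) < k + 1 by omega, show ¬ (k' : ℕ) < k by omega]
  set q : Fin K → Fin m → ℝ := fun k i => φ k i ⬝ᵥ (Sig (k : ℕ))⁻¹ *ᵥ φ k i with hq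
  have hq0 : ∀ k i, 0 ≤ q k i := fun k i => by
    simpa using (hpd k).inv.posSemidef.dotProduct_mulVec_nonneg (φ k i)
  set c : ℝ := H ^ 2 / (m * lam) with hc
  have hc1 : 1 ≤ c := by
    rw [hc, le_div_iff₀ (by positivity)]
    rw [le_div_iff₀ hm0] at hlam
    linarith
  have hqc : ∀ k, ∑ i, q k i ≤ c := by
    intro k
    have h : ∀ i, q k i ≤ (H / m) ^ 2 / lam := fun i => by
      have h1 := (hP k).dotProduct_inv_smul_one_add_mulVec_le hlam0 (φ k i)
      rw [← hSig] at h1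
      exact h1.trans (div_le_div_of_nonneg_right (hnorm k i) hlam0.le)
    refine (Finset.sum_le_sum fun i _ => h i).trans (le_of_eq ?_)
    rw [Finset.sum_const, Finset.card_univ, Fintype.card_fin, nsmul_eq_mul, hc]
    field_simp
  have hlogstep : ∀ k : Fin K, Real.log (1 + ∑ i, q k i)
      ≤ Real.log (Sig (k + 1)).det - Real.log (Sig k).det := by
    intro k
    have hpos : 0 < 1 + ∑ i, q k i := by
      have := Finset.sum_nonneg fun i (_ : i ∈ Finset.univ) => hq0 k i
      linarith
    have h := (hpd k).det_mul_one_add_sum_le_s17 (φ k)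
    rw [← hstep] at h
    have h2 := Real.log_le_log (mul_pos (hpd k).det_pos hpos) h
    rw [Real.log_mul (hpd k).det_pos.ne' hpos.ne'] at h2
    linarith
  have htele : ∑ k : Fin K, (Real.log (Sig (k + 1)).det - Real.log (Sig k).det)
      = Real.log (Sig K).det - Real.log (Sig 0).det := by
    rw [Fin.sum_univ_eq_sum_range
      (fun k => Real.log (Sig (k + 1)).det - Real.log (Sig k).det) K,
      Finset.sum_range_sub (fun k => Real.log (Sig k).det)]
  have hdet0 : Real.log (Sig 0).det = d * Real.log lam := by
    rw [hSig]
    simp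
  set L := Real.log (1 + (K : ℝ) * H ^ 2 / (lam * d * m)) with hL
  have htrace : (Sig K).trace
      ≤ Fintype.card (Fin d) * (lam * (1 + (K : ℝ) * H ^ 2 / (lam * d * m))) := by
    have h : ∑ k : Fin K, ∑ i : Fin m, φ k i ⬝ᵥ φ k i
        ≤ ∑ _k : Fin K, ∑ _i : Fin m, (H / m) ^ 2 :=
      Finset.sum_le_sum fun k _ => Finset.sum_le_sum fun i _ => hnorm k i
    simp only [Finset.sum_const, Finset.card_univ, Fintype.card_fin, nsmul_eq_mul] at h
    rw [hSig]
    simp only [Fin.is_lt, if_true, trace_add, trace_smul, trace_one, trace_sum,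
      trace_vecMulVec, Fintype.card_fin, smul_eq_mul]
    refine (add_le_add_right h _).trans (le_of_eq ?_)
    field_simp
  have hdetK : Real.log (Sig K).det ≤ d * (Real.log lam + L) := by
    have h := (hpd K).log_det_le_s17 (by positivity) htrace
    rwa [Real.log_mul hlam0.ne' (by positivity), Fintype.card_fin] at h
  have hsum : ∑ k, ∑ i, q k i ≤ 2 * c * (d * L) := by
    calc ∑ k, ∑ i, q k i
        ≤ ∑ k, 2 * c * Real.log (1 + ∑ i, q k i) := Finset.sum_le_sum fun k _ =>
          le_two_mul_mul_log_one_add (Finset.sum_nonneg fun i _ => hq0 k i) (hqc k) hc1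
      _ = 2 * c * ∑ k, Real.log (1 + ∑ i, q k i) := by rw [Finset.mul_sum]
      _ ≤ 2 * c * (d * L) := by
          refine mul_le_mul_of_nonneg_left ?_ (by linarith)
          refine (Finset.sum_le_sum fun k _ => hlogstep k).trans ?_
          rw [htele, hdet0]
          linarith
  have hcs : (∑ k, ∑ i, Real.sqrt (q k i)) ^ 2 ≤ K * m * ∑ k, ∑ i, q k i := by
    have h := sq_sum_le_card_mul_sum_sq (s := (Finset.univ : Finset (Fin K × Fin m)))
      (f := fun p => Real.sqrt (q p.1 p.2))
    simpa [Fintype.sum_prod_type, Real.sq_sqrt (hq0 _ _)] using h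
  have hfinal : (∑ k, ∑ i, Real.sqrt (q k i)) ^ 2 ≤ H ^ 2 * (2 * K * d / lam * L) := by
    refine hcs.trans ((mul_le_mul_of_nonneg_left hsum (by positivity)).trans (le_of_eq ?_))
    rw [hc]
    field_simp
  have h := Real.le_sqrt_of_sq_le hfinal
  rwa [Real.sqrt_mul (sq_nonneg H), Real.sqrt_sq hH.le] at h
end
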